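/- Suppose (X, σ) is an irreducible shift of finite type and h ∈ Homeo₊ᵒʳᵇ(𝕊X), where 𝕊X is the mapping torus of σ with its suspension flow. Then h ∈ Homeo₊ⁱˢᵒ(𝕊X): every self flow equivalence of the suspension flow of an irreducible SFT which maps each orbit onto itself is isotopic to the identity. -/

import Mathlib

open Set Topology

section FlowDefs

variable {Y Y' : Type*} [TopologicalSpace Y] [TopologicalSpace Y']

/-- A fixed point free continuous flow on a topological space. -/
def IsFlow (γ : Y → ℝ → Y) : Prop :=
  Continuous (fun p : Y × ℝ => γ p.1 p.2) ∧
  (∀ y s t, γ (γ y s) t = γ y (s + t)) ∧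
  (∀ y, γ y 0 = y) ∧
  (∀ y, ∃ t, γ y t ≠ y)

/-- The orbit of a point under a flow. -/
def flowOrbit (γ : Y → ℝ → Y) (y : Y) : Set Y := Set.range (γ y)

/-- A cross section of a flow: a closed subset `C` such that
`(x,t) ↦ γ x t` is surjective `C × ℝ → Y` and a local homeomorphism. -/
def IsCrossSection (γ : Y → ℝ → Y) (C : Set Y) : Prop :=
  IsClosed C ∧
  Function.Surjective (fun p : C × ℝ => γ p.1.1 p.2) ∧
  IsLocalHomeomorph (fun p : C × ℝ => γ p.1.1 p.2)

/-- A flow map: a continuous map sending each orbit onto an orbit by an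
orientation preserving local homeomorphism. -/
def IsFlowMap (γ : Y → ℝ → Y) (γ' : Y' → ℝ → Y') (h : Y → Y') : Prop :=
  Continuous h ∧
  (∀ y, h '' flowOrbit γ y = flowOrbit γ' (h y)) ∧
  (∀ y, ∃ ε > (0:ℝ), ∃ c : ℝ → ℝ,
    ContinuousOn c (Ioo (-ε) ε) ∧ StrictMonoOn c (Ioo (-ε) ε) ∧ c 0 = 0 ∧
    ∀ t : ℝ, |t| < ε → h (γ y t) = γ' (h y) (c t))

/-- Membership in `Homeo₊(Y)`: a self flow equivalence. -/
def MemHomeoPlus (γ : Y → ℝ → Y) (h : Y → Y) : Prop :=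
  IsFlowMap γ γ h ∧ IsHomeomorph h

/-- Membership in `Homeo₊ᵒʳᵇ(Y)`: a self flow equivalence mapping each orbit onto itself. -/
def MemHomeoPlusOrb (γ : Y → ℝ → Y) (h : Y → Y) : Prop :=
  MemHomeoPlus γ h ∧ ∀ y, h '' flowOrbit γ y = flowOrbit γ y

/-- Membership in `Homeo₊ⁱˢᵒ(Y)`: an element of `Homeo₊ᵒʳᵇ(Y)` isotopic to the identity
within `Homeo₊(Y)`. -/
def MemHomeoPlusIso (γ : Y → ℝ → Y) (h : Y → Y) : Prop :=
  MemHomeoPlusOrb γ h ∧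
  ∃ H : Y → ℝ → Y,
    ContinuousOn (fun p : Y × ℝ => H p.1 p.2) (Set.univ ×ˢ Set.Icc 0 1) ∧
    (∀ t ∈ Set.Icc (0:ℝ) 1, MemHomeoPlus γ (fun y => H y t)) ∧
    (∀ y, H y 0 = y) ∧ (∀ y, H y 1 = h y)

/-- A discrete cross section for a (homeomorphic) self-map `T` of a space:
a closed set meeting every orbit, with well-defined continuous return time. -/
def IsDiscreteCrossSection {Z : Type*} [TopologicalSpace Z] (T : Z → Z) (K : Set Z) : Prop :=
  IsClosed K ∧
  (∀ z : Z, ∃ x ∈ K, ∃ k : ℕ, T^[k] x = z) ∧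
  ∃ r : K → ℕ, Continuous r ∧ ∀ x : K, IsLeast {k : ℕ | 1 ≤ k ∧ T^[k] (x : Z) ∈ K} (r x)

end FlowDefs

section SubshiftDefs

/-- The left shift on bisequences. -/
def shiftMap {A : Type*} : (ℤ → A) → (ℤ → A) := fun x n => x (n + 1)

/-- The word `w` occurs in `x` at position `n`. -/
def wordOccursAt {A : Type*} (w : List A) (x : ℤ → A) (n : ℤ) : Prop :=
  ∀ (i : ℕ) (hi : i < w.length), x (n + i) = w.get ⟨i, hi⟩

/-- The word `w` occurs in some point of `X`. -/
def wordOccursIn {A : Type*} (w : List A) (X : Set (ℤ → A)) : Prop :=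
  ∃ x ∈ X, ∃ n : ℤ, wordOccursAt w x n

/-- A subshift: nonempty, closed, shift-invariant subset of `A^ℤ`. -/
def IsSubshift {A : Type*} [TopologicalSpace A] (X : Set (ℤ → A)) : Prop :=
  X.Nonempty ∧ IsClosed X ∧ shiftMap '' X = X

/-- A shift of finite type: the set of bisequences avoiding a finite set of forbidden words. -/
def IsSFT {A : Type*} (X : Set (ℤ → A)) : Prop :=
  ∃ F : Set (List A), F.Finite ∧ X = {x | ∀ w ∈ F, ∀ n : ℤ, ¬ wordOccursAt w x n}

/-- An irreducible subshift. -/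
def IsIrreducibleSubshift {A : Type*} (X : Set (ℤ → A)) : Prop :=
  ∀ u v : List A, wordOccursIn u X → wordOccursIn v X →
    ∃ w : List A, wordOccursIn (u ++ w ++ v) X

end SubshiftDefs

section SymbolicDynamics

variable {A : Type*}

/-- Two bisequences agree on the central window `[-N, N]`. -/
def AgreeOn (N : ℕ) (x y : ℤ → A) : Prop :=
  ∀ m : ℤ, -(N : ℤ) ≤ m → m ≤ N → x m = y m

lemma AgreeOn.symm {N : ℕ} {x y : ℤ → A} (h : AgreeOn N x y) : AgreeOn N y x :=
  fun m h₁ h₂ => (h m h₁ h₂).symm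

lemma AgreeOn.trans {N : ℕ} {x y z : ℤ → A} (h : AgreeOn N x y) (h' : AgreeOn N y z) :
    AgreeOn N x z :=
  fun m h₁ h₂ => (h m h₁ h₂).trans (h' m h₁ h₂)

lemma AgreeOn.mono {M N : ℕ} (hMN : M ≤ N) {x y : ℤ → A} (h : AgreeOn N x y) :
    AgreeOn M x y :=
  fun m h₁ h₂ => h m (by omega) (by omega)

lemma wordOccursAt_translate {w : List A} {x : ℤ → A} {k n : ℤ} :
    wordOccursAt w (fun m => x (m + k)) n ↔ wordOccursAt w x (n + k) := by
  simp only [wordOccursAt, add_right_comm]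

lemma IsSFT.translate_mem {X : Set (ℤ → A)} (hX : IsSFT X) (k : ℤ) {x : ℤ → A} (hx : x ∈ X) :
    (fun m => x (m + k)) ∈ X := by
  obtain ⟨F, -, rfl⟩ := hX
  intro w hw n h
  exact hx w hw (n + k) (wordOccursAt_translate.1 h)

/-- The `k`-th power of the shift on a shift of finite type. -/
def sftShift {X : Set (ℤ → A)} (hX : IsSFT X) (k : ℤ) (x : X) : X :=
  ⟨fun m => (x : ℤ → A) (m + k), hX.translate_mem k x.2⟩

@[simp] lemma sftShift_apply {X : Set (ℤ → A)} (hX : IsSFT X) (k : ℤ) (x : X) (m : ℤ) :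
    (sftShift hX k x : ℤ → A) m = (x : ℤ → A) (m + k) := rfl

lemma sftShift_zero {X : Set (ℤ → A)} (hX : IsSFT X) (x : X) : sftShift hX 0 x = x := by
  ext m; simp

lemma sftShift_add {X : Set (ℤ → A)} (hX : IsSFT X) (j k : ℤ) (x : X) :
    sftShift hX (j + k) x = sftShift hX j (sftShift hX k x) := by
  ext m; simp [add_assoc]

lemma continuous_sftShift [TopologicalSpace A] {X : Set (ℤ → A)} (hX : IsSFT X) (k : ℤ) :
    Continuous (sftShift hX k) := by
  refine Continuous.subtype_mk (continuous_pi fun m => ?_) _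
  exact (continuous_apply (m + k)).comp continuous_subtype_val

lemma isOpen_setOf_agreeOn [TopologicalSpace A] [DiscreteTopology A] (N : ℕ) (x : ℤ → A) :
    IsOpen {y : ℤ → A | AgreeOn N x y} := by
  have : {y : ℤ → A | AgreeOn N x y} =
      ⋂ m ∈ Set.Icc (-(N : ℤ)) N, (fun y : ℤ → A => y m) ⁻¹' {x m} := by
    ext y
    simp [AgreeOn, eq_comm]
  rw [this]
  exact (Set.finite_Icc _ _).isOpen_biInter fun m _ =>
    (isOpen_discrete _).preimage (continuous_apply m)

lemma exists_agreeOn_subset [TopologicalSpace A] {U : Set (ℤ → A)} (hU : IsOpen U)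
    {x : ℤ → A} (hx : x ∈ U) : ∃ N : ℕ, ∀ y, AgreeOn N x y → y ∈ U := by
  obtain ⟨I, u, hu, hIU⟩ := isOpen_pi_iff.1 hU x hx
  refine ⟨I.sup Int.natAbs, fun y hy => hIU fun i hi => ?_⟩
  have h₁ : i.natAbs ≤ I.sup Int.natAbs := Finset.le_sup (f := Int.natAbs) hi
  rw [← hy i (by omega) (by omega)]
  exact (hu i hi).2

/-- A continuous function from a compact shift space to a discrete space depends only on a
finite window. -/
lemma exists_window [TopologicalSpace A] [DiscreteTopology A] {X : Set (ℤ → A)} [CompactSpace X]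
    {Z : Type*} [TopologicalSpace Z] [DiscreteTopology Z] {g : X → Z} (hg : Continuous g) :
    ∃ N : ℕ, ∀ x y : X, AgreeOn N (x : ℤ → A) y → g y = g x := by
  suffices ∃ N : ℕ, ∀ x ∈ (Set.univ : Set X), ∀ y : X, AgreeOn N (x : ℤ → A) y → g y = g x by
    obtain ⟨N, hN⟩ := this
    exact ⟨N, fun x => hN x (Set.mem_univ x)⟩
  refine isCompact_univ.induction_on
    (p := fun s : Set X => ∃ N : ℕ, ∀ x ∈ s, ∀ y : X, AgreeOn N (x : ℤ → A) y → g y = g x)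
    ⟨0, by simp⟩ ?_ ?_ ?_
  · rintro s t hst ⟨N, hN⟩
    exact ⟨N, fun x hx => hN x (hst hx)⟩
  · rintro s t ⟨M, hM⟩ ⟨N, hN⟩
    refine ⟨max M N, ?_⟩
    rintro x (hx | hx) y hxy
    · exact hM x hx y (hxy.mono (le_max_left _ _))
    · exact hN x hx y (hxy.mono (le_max_right _ _))
  · intro x _
    obtain ⟨U, hU, hUg⟩ := isOpen_induced_iff.1 ((isOpen_discrete {g x}).preimage hg)
    have hmem : ∀ y : X, (y : ℤ → A) ∈ U ↔ g y = g x := fun y => by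
      change y ∈ Subtype.val ⁻¹' U ↔ _
      rw [hUg]; rfl
    obtain ⟨N, hN⟩ := exists_agreeOn_subset hU ((hmem x).2 rfl)
    refine ⟨{y : X | AgreeOn N (x : ℤ → A) y}, mem_nhdsWithin_of_mem_nhds
      (((isOpen_setOf_agreeOn N (x : ℤ → A)).preimage continuous_subtype_val).mem_nhds
        fun m _ _ => rfl), N, fun y hy z hyz => ?_⟩
    rw [(hmem z).1 (hN z (AgreeOn.trans hy hyz)), (hmem y).1 (hN y hy)]

/-- The word `x_{-N} ⋯ x_N`. -/
def centralWord (N : ℕ) (x : ℤ → A) : List A :=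
  List.ofFn fun i : Fin (2 * N + 1) => x (-N + (i : ℕ))

lemma wordOccursAt_centralWord {N : ℕ} {x y : ℤ → A} {n : ℤ} :
    wordOccursAt (centralWord N x) y n ↔ AgreeOn N x (fun m => y (m + (n + N))) := by
  constructor
  · intro h m h₁ h₂
    have := h (m + N).toNat (by simp [centralWord]; omega)
    simp only [centralWord, List.get_eq_getElem, List.getElem_ofFn] at this
    rw [show -(N : ℤ) + ((m + N).toNat : ℤ) = m by omega,
      show n + ((m + N).toNat : ℤ) = m + (n + N) by omega] at this
    exact this.symm
  · intro h i hi
    simp only [centralWord, List.length_ofFn] at hi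
    have := h (-N + i) (by omega) (by omega)
    simp only [centralWord, List.get_eq_getElem, List.getElem_ofFn]
    rw [this]
    congr 1
    ring

lemma wordOccursAt_append {u v : List A} {x : ℤ → A} {n : ℤ} (h : wordOccursAt (u ++ v) x n) :
    wordOccursAt u x n ∧ wordOccursAt v x (n + u.length) := by
  constructor
  · intro i hi
    have := h i (by simp; omega)
    simpa [List.getElem_append_left hi] using this
  · intro i hi
    have := h (u.length + i) (by simp; omega)
    simpa [add_assoc] using this

/-- An irreducible shift of finite type has a point whose forward orbit visits every cylinder. -/
lemma exists_forward_transitive [Finite A] [TopologicalSpace A] [DiscreteTopology A]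
    {X : Set (ℤ → A)} (hX : IsSFT X) (hne : X.Nonempty) [CompactSpace X]
    (hirr : IsIrreducibleSubshift X) :
    ∃ x₀ : X, ∀ (N : ℕ) (x : X), ∃ j : ℕ, AgreeOn N (x : ℤ → A) (sftShift hX j x₀) := by
  have hne' : Nonempty X := hne.to_subtype
  let O : {w : List A // wordOccursIn w X} → Set X :=
    fun w => {x : X | ∃ j : ℕ, wordOccursAt w.1 (x : ℤ → A) j}
  have hopen : ∀ w, IsOpen (O w) := by
    intro w
    have : O w = ⋃ j : ℕ, ⋂ i : Fin w.1.length,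
        (fun x : X => (x : ℤ → A) ((j : ℤ) + (i : ℕ))) ⁻¹' {w.1.get i} := by
      ext x
      simp only [O, wordOccursAt, Set.mem_ofPred_eq, Set.mem_iUnion, Set.mem_iInter,
        Set.mem_preimage, Set.mem_singleton_iff]
      exact exists_congr fun j => ⟨fun h i => h i.1 i.2, fun h i hi => h ⟨i, hi⟩⟩
    rw [this]
    exact isOpen_iUnion fun j => isOpen_iInter_of_finite fun i =>
      (isOpen_discrete _).preimage ((continuous_apply _).comp continuous_subtype_val)
  have hdense : ∀ w, Dense (O w) := by
    intro w
    rw [dense_iff_inter_open]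
    rintro U hU ⟨x, hx⟩
    obtain ⟨V, hV, rfl⟩ := isOpen_induced_iff.1 hU
    obtain ⟨N, hN⟩ := exists_agreeOn_subset hV hx
    have hocc : wordOccursIn (centralWord N (x : ℤ → A)) X := by
      refine ⟨x, x.2, -N, wordOccursAt_centralWord.2 fun m _ _ => ?_⟩
      simp
    obtain ⟨v, z, hz, n, hzn⟩ := hirr _ _ hocc w.2
    obtain ⟨h₁, h₂⟩ := wordOccursAt_append hzn
    have h₃ := wordOccursAt_centralWord.1 (wordOccursAt_append h₁).1
    refine ⟨sftShift hX (n + N) ⟨z, hz⟩, hN _ h₃, N + 1 + v.length, ?_⟩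
    refine wordOccursAt_translate.2 ?_
    convert h₂ using 1
    simp [centralWord]
    ring
  obtain ⟨x₀, hx₀⟩ := (dense_iInter_of_isOpen hopen hdense).nonempty
  refine ⟨x₀, fun N x => ?_⟩
  have hocc : wordOccursIn (centralWord N (x : ℤ → A)) X := by
    refine ⟨x, x.2, -N, wordOccursAt_centralWord.2 fun m _ _ => ?_⟩
    simp
  obtain ⟨j, hj⟩ := Set.mem_iInter.1 hx₀ ⟨_, hocc⟩
  refine ⟨j + N, ?_⟩
  have := wordOccursAt_centralWord.1 hj
  intro m h₁ h₂
  rw [this m h₁ h₂]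
  simp

lemma denseRange_of_forward_transitive [TopologicalSpace A] {X : Set (ℤ → A)} (hX : IsSFT X)
    {x₀ : X} (h : ∀ (N : ℕ) (x : X), ∃ j : ℕ, AgreeOn N (x : ℤ → A) (sftShift hX j x₀)) :
    DenseRange fun j : ℕ => sftShift hX j x₀ := by
  rw [DenseRange, dense_iff_inter_open]
  rintro U hU ⟨x, hx⟩
  obtain ⟨V, hV, rfl⟩ := isOpen_induced_iff.1 hU
  obtain ⟨N, hN⟩ := exists_agreeOn_subset hV hx
  obtain ⟨j, hj⟩ := h N x
  exact ⟨_, hN _ hj, j, rfl⟩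

/-- The `p`-periodic bisequence obtained by repeating `y_0 ⋯ y_{p-1}`. -/
def periodize (p : ℕ) (y : ℤ → A) : ℤ → A := fun k => y (k % p)

lemma periodize_eq {p N : ℕ} (hp : 0 < p) {y : ℤ → A} (hy : AgreeOn N (fun m => y (m + p)) y)
    {k : ℤ} (h₁ : -(N : ℤ) ≤ k) (h₂ : k ≤ p + N) : periodize p y k = y k := by
  have hper : ∀ k : ℤ, periodize p y (k + p) = periodize p y k := fun k => by
    simp [periodize]
  have hup : ∀ n : ℕ, n ≤ p + N → periodize p y n = y n := by
    intro n
    induction n using Nat.strong_induction_on with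
    | _ n ih =>
      intro hn
      by_cases hnp : n < p
      · simp only [periodize]
        rw [Int.emod_eq_of_lt (by omega) (by omega)]
      · obtain ⟨m, rfl⟩ := Nat.exists_eq_add_of_le (not_lt.1 hnp)
        have e : ((p + m : ℕ) : ℤ) = (m : ℤ) + p := by push_cast; ring
        rw [e, hper, ih m (by omega) (by omega)]
        exact (hy m (by omega) (by omega)).symm
  have hdown : ∀ n : ℕ, n ≤ N → periodize p y (-(n : ℤ)) = y (-(n : ℤ)) := by
    intro n
    induction n using Nat.strong_induction_on with
    | _ n ih =>
      intro hn
      rw [← hy (-(n : ℤ)) (by omega) (by omega), ← hper]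
      by_cases hnp : n < p
      · have e : -(n : ℤ) + p = ((p - n : ℕ) : ℤ) := by omega
        simp only [e]
        exact hup _ (by omega)
      · have e : -(n : ℤ) + p = -((n - p : ℕ) : ℤ) := by omega
        simp only [e]
        exact ih _ (by omega) (by omega)
  rcases le_total 0 k with hk | hk
  · obtain ⟨n, rfl⟩ := Int.eq_ofNat_of_zero_le hk
    exact hup n (by omega)
  · obtain ⟨n, hn⟩ := Int.eq_ofNat_of_zero_le (neg_nonneg.2 hk)
    obtain rfl : k = -(n : ℤ) := by omega
    exact hdown n (by omega)

/-- Closing lemma: in a shift of finite type, a sufficiently good return can be closed up to a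
periodic point. -/
lemma IsSFT.exists_periodize_mem {X : Set (ℤ → A)} (hX : IsSFT X) :
    ∃ L : ℕ, ∀ N p : ℕ, L ≤ N → 0 < p → ∀ y ∈ X, AgreeOn N (fun m => y (m + p)) y →
      periodize p y ∈ X := by
  obtain ⟨F, hF, rfl⟩ := hX
  obtain ⟨L, hL⟩ := (hF.image List.length).bddAbove
  refine ⟨L, fun N p hLN hp y hy hyp w hw n hwn => hy w hw (n % p) fun i hi => ?_⟩
  have hwL : w.length ≤ L := hL ⟨w, hw, rfl⟩
  have h0 := Int.emod_nonneg n (show (p : ℤ) ≠ 0 by omega)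
  have h1 := Int.emod_lt_of_pos n (show (0 : ℤ) < p by omega)
  rw [← hwn i hi, ← periodize_eq hp hyp (by omega) (by omega)]
  simp [periodize]

/-- Livšic theorem for locally constant functions: on an irreducible shift of finite type, a
continuous integer valued function whose sums over periodic orbits vanish is a coboundary. -/
lemma exists_coboundary [TopologicalSpace A] [DiscreteTopology A] {X : Set (ℤ → A)}
    [CompactSpace X] (hX : IsSFT X) {x₀ : X}
    (hx₀ : ∀ (N : ℕ) (x : X), ∃ j : ℕ, AgreeOn N (x : ℤ → A) (sftShift hX j x₀))
    {g : X → ℤ} (hg : Continuous g)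
    (hper : ∀ (x : X) (p : ℕ), 0 < p → sftShift hX p x = x →
      ∑ l ∈ Finset.range p, g (sftShift hX l x) = 0) :
    ∃ b : X → ℤ, Continuous b ∧ ∀ x, g x = b (sftShift hX 1 x) - b x := by
  obtain ⟨L, hL⟩ := hX.exists_periodize_mem
  obtain ⟨M, hM⟩ := exists_window hg
  set N := max L M with hN
  let B : ℕ → ℤ := fun j => ∑ l ∈ Finset.range j, g (sftShift hX l x₀)
  have hlt : ∀ i p : ℕ, 0 < p →
      AgreeOn N (sftShift hX (i + p : ℕ) x₀ : ℤ → A) (sftShift hX i x₀) → B (i + p) = B i := by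
    intro i p hp hag
    have hy : AgreeOn N (fun m => (sftShift hX i x₀ : ℤ → A) (m + p)) (sftShift hX i x₀) := by
      intro m h₁ h₂
      rw [← hag m h₁ h₂]
      simp only [sftShift_apply]
      push_cast; ring_nf
    let z : X := ⟨periodize p (sftShift hX i x₀), hL N p (le_max_left _ _) hp _ (Subtype.prop _) hy⟩
    have hz : sftShift hX p z = z := by
      ext m; simp [z, periodize]
    have hsum := hper z p hp hz
    simp only [B, Finset.sum_range_add, add_eq_left]
    rw [← hsum]
    refine Finset.sum_congr rfl fun l hl => ?_
    rw [Finset.mem_range] at hl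
    refine hM _ _ fun m h₁ h₂ => ?_
    simp only [sftShift_apply, z]
    rw [periodize_eq hp hy (by omega) (by omega)]
    simp only [sftShift_apply]
    push_cast; ring_nf
  have hwd : ∀ i j : ℕ, AgreeOn N (sftShift hX i x₀ : ℤ → A) (sftShift hX j x₀) → B i = B j := by
    intro i j hij
    rcases lt_trichotomy i j with h | rfl | h
    · obtain ⟨p, rfl⟩ := Nat.exists_eq_add_of_lt h
      exact (hlt i (p + 1) (by omega) hij.symm).symm
    · rfl
    · obtain ⟨p, rfl⟩ := Nat.exists_eq_add_of_lt h
      exact hlt j (p + 1) (by omega) hij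
  choose J hJ using hx₀ N
  have hb : ∀ (x : X) (j : ℕ), AgreeOn N (x : ℤ → A) (sftShift hX j x₀) → B (J x) = B j :=
    fun x j h => hwd _ _ ((hJ x).symm.trans h)
  refine ⟨fun x => B (J x), ?_, fun x => ?_⟩
  · refine IsLocallyConstant.continuous (IsLocallyConstant.iff_exists_open _ |>.2 fun x => ?_)
    refine ⟨{y : X | AgreeOn N (x : ℤ → A) y},
      (isOpen_setOf_agreeOn N (x : ℤ → A)).preimage continuous_subtype_val,
      fun m _ _ => rfl, fun y hy => hb y _ (AgreeOn.trans (AgreeOn.symm hy) (hJ x))⟩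
  · obtain ⟨j, hj⟩ := hx₀ (N + 1) x
    have h₀ : B (J x) = B j := hb x j (hj.mono (by omega))
    have h₁ : B (J (sftShift hX 1 x)) = B (j + 1) := by
      refine hb _ _ fun m h₁ h₂ => ?_
      rw [sftShift_apply, hj (m + 1) (by push_cast; omega) (by push_cast; omega)]
      simp only [sftShift_apply]
      push_cast; ring_nf
    change g x = B (J _) - B (J x)
    rw [h₀, h₁, hM _ _ (hj.mono (by omega) : AgreeOn M _ _).symm]
    simp [B, Finset.sum_range_succ]

end SymbolicDynamics

section Isotopy

variable {Y : Type*} [TopologicalSpace Y]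

/-- An orbit preserving map with a continuous cocycle is isotopic to the identity through
`y ↦ γ y (t * β y)`. -/
lemma memHomeoPlusIso_of_cocycle [CompactSpace Y] [T2Space Y] {γ : Y → ℝ → Y}
    (hcont : Continuous fun p : Y × ℝ => γ p.1 p.2) (hadd : ∀ y s t, γ (γ y s) t = γ y (s + t))
    (hzero : ∀ y, γ y 0 = y) {h : Y → Y} (hh : MemHomeoPlusOrb γ h) {β : Y → ℝ}
    (hβ : Continuous β) (hhβ : ∀ y, h y = γ y (β y))
    (hmono : ∀ y, StrictMono fun r => r + β (γ y r)) : MemHomeoPlusIso γ h := by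
  obtain ⟨M, hM⟩ : ∃ M, ∀ y, |β y| ≤ M := by
    obtain ⟨M, hM⟩ := (isCompact_range hβ).isBounded.exists_norm_le
    exact ⟨M, fun y => hM _ ⟨y, rfl⟩⟩
  refine ⟨hh, fun y t => γ y (t * β y), ?_, ?_, fun y => by simp [hzero], fun y => by simp [hhβ]⟩
  · exact (hcont.comp (continuous_fst.prodMk
      (continuous_snd.mul (hβ.comp continuous_fst)))).continuousOn
  rintro t ⟨ht₀, ht₁⟩
  have hγy : ∀ y, Continuous (γ y) := fun y => hcont.comp (continuous_const.prodMk continuous_id)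
  let ψ : Y → ℝ → ℝ := fun y r => r + t * β (γ y r)
  have hψc : ∀ y, Continuous (ψ y) := fun y =>
    continuous_id.add (continuous_const.mul (hβ.comp (hγy y)))
  have hψm : ∀ y, StrictMono (ψ y) := by
    intro y r s hrs
    have h₁ : r + β (γ y r) < s + β (γ y s) := hmono y hrs
    change r + t * β (γ y r) < s + t * β (γ y s)
    rcases ht₁.lt_or_eq with ht | rfl
    · nlinarith
    · simpa using h₁
  have hψs : ∀ y c, ∃ r, ψ y r = c := by
    intro y c
    have hb : ∀ r, |t * β (γ y r)| ≤ M := fun r => by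
      rw [abs_mul, abs_of_nonneg ht₀]
      nlinarith [hM (γ y r), abs_nonneg (β (γ y r))]
    refine mem_range_of_exists_le_of_exists_ge (hψc y) ⟨c - M, ?_⟩ ⟨c + M, ?_⟩
    · have := (abs_le.1 (hb (c - M))).2
      simp only [ψ]; linarith
    · have := (abs_le.1 (hb (c + M))).1
      simp only [ψ]; linarith
  have hflow : ∀ y r, γ (γ y r) (t * β (γ y r)) = γ y (ψ y r) := fun y r => hadd _ _ _
  have hψ₀ : ∀ y, ψ y 0 = t * β y := fun y => by simp [ψ, hzero]
  have hHc : Continuous fun y => γ y (t * β y) :=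
    hcont.comp (continuous_id.prodMk (continuous_const.mul hβ))
  have hinj : Function.Injective fun y => γ y (t * β y) := by
    intro y y' hyy'
    change γ y (t * β y) = γ y' (t * β y') at hyy'
    obtain ⟨q, rfl⟩ : ∃ q, y' = γ y q := by
      refine ⟨t * β y - t * β y', ?_⟩
      rw [sub_eq_add_neg, ← hadd, hyy', hadd, add_neg_cancel, hzero]
    rw [hflow, ← hψ₀] at hyy'
    set q' := ψ y q - ψ y 0 with hq'
    have hper : γ y q' = y := by
      rw [hq', sub_eq_add_neg, ← hadd, ← hyy', hadd, add_neg_cancel, hzero]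
    have : ψ y q' = ψ y q := by
      simp only [ψ]
      rw [hper]
      simp only [hq', hψ₀]
      ring
    rw [← (hψm y).injective this, hper]
  have hsurj : Function.Surjective fun y => γ y (t * β y) := by
    intro y
    obtain ⟨r, hr⟩ := hψs y 0
    exact ⟨γ y r, by simp only [hflow, hr, hzero]⟩
  refine ⟨⟨hHc, fun y => ?_, fun y => ⟨1, one_pos, fun r => ψ y r - ψ y 0,
    ((hψc y).sub continuous_const).continuousOn,
    fun r _ s _ hrs => sub_lt_sub_right (hψm y hrs) _, by simp, fun r _ => ?_⟩⟩,
    isHomeomorph_iff_continuous_bijective.2 ⟨hHc, hinj, hsurj⟩⟩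
  · ext z
    simp only [flowOrbit, Set.mem_image, Set.mem_range]
    constructor
    · rintro ⟨_, ⟨r, rfl⟩, rfl⟩
      refine ⟨ψ y r - t * β y, ?_⟩
      rw [hadd, hflow]
      congr 1
      ring
    · rintro ⟨r, rfl⟩
      obtain ⟨s, hs⟩ := hψs y (t * β y + r)
      exact ⟨_, ⟨s, rfl⟩, by rw [hflow, hs, hadd]⟩
  · simp only [hflow, hadd, hψ₀]
    congr 1
    ring

end Isotopy

section Lifting

/-- A map from a compact totally disconnected Hausdorff space lifts through a surjective local
homeomorphism. -/
lemma IsLocalHomeomorph.exists_lift_of_totallyDisconnected {X E Y : Type*} [TopologicalSpace X]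
    [CompactSpace X] [T2Space X] [TotallyDisconnectedSpace X] [TopologicalSpace E]
    [TopologicalSpace Y] {p : E → Y} (hp : IsLocalHomeomorph p) (hsurj : Function.Surjective p)
    {g : X → Y} (hg : Continuous g) : ∃ F : X → E, Continuous F ∧ ∀ x, p (F x) = g x := by
  classical
  suffices ∃ U : Set X, IsClopen U ∧ Set.univ ⊆ U ∧
      ∃ F : X → E, ContinuousOn F U ∧ ∀ x ∈ U, p (F x) = g x by
    obtain ⟨U, -, hU, F, hF, hpF⟩ := this
    obtain rfl := Set.univ_subset_iff.1 hU
    exact ⟨F, continuousOn_univ.1 hF, fun x => hpF x (Set.mem_univ x)⟩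
  refine isCompact_univ.induction_on (p := fun s : Set X => ∃ U : Set X, IsClopen U ∧ s ⊆ U ∧
    ∃ F : X → E, ContinuousOn F U ∧ ∀ x ∈ U, p (F x) = g x) ?_ ?_ ?_ ?_
  · exact ⟨∅, isClopen_empty, subset_rfl, fun x => (hsurj (g x)).choose, by simp, by simp⟩
  · rintro s t hst ⟨U, hU, htU, h⟩
    exact ⟨U, hU, hst.trans htU, h⟩
  · rintro s t ⟨U, hU, hsU, F, hF, hpF⟩ ⟨V, hV, htV, G, hG, hpG⟩
    refine ⟨U ∪ V, hU.union hV, Set.union_subset_union hsU htV, U.piecewise F G, ?_, ?_⟩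
    · rw [hU.isOpen.continuousOn_iff] at hF
      rw [hV.isOpen.continuousOn_iff] at hG
      intro x hx
      by_cases hxU : x ∈ U
      · refine ((hF hxU).congr ?_).continuousWithinAt
        filter_upwards [hU.isOpen.mem_nhds hxU] with z hz
        exact (Set.piecewise_eq_of_mem _ _ _ hz).symm
      · refine ((hG (hx.resolve_left hxU)).congr ?_).continuousWithinAt
        filter_upwards [hU.compl.isOpen.mem_nhds hxU] with z hz
        exact (Set.piecewise_eq_of_notMem _ _ _ hz).symm
    · intro x hx
      by_cases hxU : x ∈ U
      · rw [Set.piecewise_eq_of_mem _ _ _ hxU]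
        exact hpF x hxU
      · rw [Set.piecewise_eq_of_notMem _ _ _ hxU]
        exact hpG x (hx.resolve_left hxU)
  · intro x _
    obtain ⟨e, he⟩ := hsurj (g x)
    obtain ⟨q, heq, rfl⟩ := hp e
    have hx : x ∈ g ⁻¹' q.target := by
      change g x ∈ q.target
      rw [← he]
      exact q.map_source heq
    obtain ⟨U, hU, hxU, hUq⟩ := compact_exists_isClopen_in_isOpen (q.open_target.preimage hg) hx
    exact ⟨U, mem_nhdsWithin_of_mem_nhds (hU.isOpen.mem_nhds hxU), U, hU, subset_rfl,
      fun x => q.symm (g x), q.continuousOn_symm.comp hg.continuousOn hUq,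
      fun x hx => q.right_inv (hUq hx)⟩

lemma continuous_int_of_continuous_cast {Z : Type*} [TopologicalSpace Z] {N : Z → ℤ}
    (h : Continuous fun z => (N z : ℝ)) : Continuous N :=
  Int.isClosedEmbedding_coe_real.isInducing.continuous_iff.2 h

/-- A continuous real function which is strictly increasing near each point is strictly
increasing. -/
lemma strictMono_of_local {s : ℝ → ℝ} (hs : Continuous s)
    (hloc : ∀ t, ∃ ε > (0 : ℝ), ∀ r, 0 < r → r < ε → s t < s (t + r)) : StrictMono s := by
  intro a b hab
  obtain ⟨m, hm, hmax⟩ := isCompact_Icc.exists_isMaxOn (Set.nonempty_Icc.2 hab.le) hs.continuousOn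
  have key : ∀ c ∈ Set.Icc a b, IsMaxOn s (Set.Icc a b) c → c = b := by
    intro c hc hcmax
    by_contra hcb
    have hcb' : c < b := lt_of_le_of_ne hc.2 hcb
    obtain ⟨ε, hε, h⟩ := hloc c
    have hr : 0 < min (ε / 2) (b - c) := lt_min (by linarith) (by linarith)
    have h₁ := h _ hr ((min_le_left _ _).trans_lt (by linarith))
    have h₂ : s (c + min (ε / 2) (b - c)) ≤ s c :=
      hcmax ⟨by linarith [hc.1], by linarith [min_le_right (ε / 2) (b - c)]⟩
    linarith
  obtain rfl := key m hm hmax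
  have hle : s a ≤ s m := hmax (Set.left_mem_Icc.2 hab.le)
  refine hle.lt_of_ne fun heq => hab.ne (key a (Set.left_mem_Icc.2 hab.le) fun c hc => ?_)
  change s c ≤ s a
  rw [heq]
  exact hmax hc

end Lifting

section MappingTorus

variable {X : Type*} [TopologicalSpace X] {S : ℤ → X → X}
  {Y : Type*} [TopologicalSpace Y] {π : X × ℝ → Y}

/-- The projection onto a mapping torus is a covering map. -/
lemma isCoveringMap_mappingTorus (hS₀ : ∀ x, S 0 x = x)
    (hSadd : ∀ j k x, S (j + k) x = S j (S k x)) (hSc : ∀ k, Continuous (S k))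
    (hπ : IsQuotientMap π)
    (hfib : ∀ x x' t t', π (x, t) = π (x', t') ↔ ∃ n : ℤ, x' = S n x ∧ t' = t - n) :
    IsCoveringMap π := by
  let _ : AddAction ℤ (X × ℝ) :=
    { vadd := fun n p => (S n p.1, p.2 - n)
      zero_vadd := fun p => by
        change (S 0 p.1, p.2 - ((0 : ℤ) : ℝ)) = p
        simp [hS₀]
      add_vadd := fun m n p => by
        change (S (m + n) p.1, p.2 - ((m + n : ℤ) : ℝ)) = (S m (S n p.1), p.2 - n - m)
        rw [hSadd]
        push_cast
        congr 1
        ring }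
  have hv : ∀ (n : ℤ) (p : X × ℝ), n +ᵥ p = (S n p.1, p.2 - n) := fun _ _ => rfl
  have : IsAddQuotientCoveringMap π ℤ :=
    { toIsQuotientMap := hπ
      continuous_const_vadd := fun n =>
        ((hSc n).comp continuous_fst).prodMk (continuous_snd.sub continuous_const)
      apply_eq_iff_mem_orbit := by
        rintro ⟨x, t⟩ ⟨x', t'⟩
        rw [eq_comm, hfib, AddAction.mem_orbit_iff]
        simp only [hv, Prod.mk.injEq, eq_comm]
      disjoint := by
        rintro ⟨x, t⟩
        refine ⟨Set.univ ×ˢ Set.Ioo (t - 1 / 2) (t + 1 / 2),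
          prod_mem_nhds Filter.univ_mem (Ioo_mem_nhds (by linarith) (by linarith)), ?_⟩
        rintro n ⟨_, ⟨⟨y, s⟩, ⟨-, hs⟩, rfl⟩, ⟨-, hs'⟩⟩
        simp only [hv, Set.mem_Ioo] at hs hs'
        have h₁ : (n : ℝ) < 1 := by linarith [hs.2, hs'.1]
        have h₂ : (-1 : ℝ) < n := by linarith [hs.1, hs'.2]
        have h₃ : n < 1 := by exact_mod_cast h₁
        have h₄ : -1 < n := by exact_mod_cast h₂
        omega }
  exact this.isCoveringMap

/-- A continuous map sending the suspension flow over a totally disconnected compact base to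
itself lifts to the product `X × ℝ`, the lift being fibred over a map of the base. -/
lemma exists_fibred_lift [CompactSpace X] [T2Space X] [TotallyDisconnectedSpace X]
    (hπ : IsCoveringMap π) (hsurj : Function.Surjective π) {h : Y → Y} (hh : Continuous h) :
    ∃ (f : X → X) (s : X → ℝ → ℝ), Continuous f ∧ Continuous (fun p : X × ℝ => s p.1 p.2) ∧
      ∀ x t, h (π (x, t)) = π (f x, s x t) := by
  have hπc : Continuous π := hπ.continuous
  obtain ⟨F, hF, hpF⟩ := hπ.isLocalHomeomorph.exists_lift_of_totallyDisconnected hsurj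
    (g := fun x => h (π (x, 0))) (by fun_prop)
  let H : C(unitInterval × (X × ℝ), Y) :=
    ⟨fun p => h (π (p.2.1, (p.1 : ℝ) * p.2.2)), by fun_prop⟩
  let f₀ : C(X × ℝ, X × ℝ) := ⟨fun p => F p.1, by fun_prop⟩
  have hH₀ : ∀ p, H (0, p) = π (f₀ p) := fun p => by simp [H, f₀, hpF]
  let G : X × ℝ → X × ℝ := fun p => hπ.liftHomotopy H f₀ hH₀ (1, p)
  have hG : Continuous G := by
    have := (hπ.liftHomotopy H f₀ hH₀).continuous
    fun_prop
  have hpG : ∀ p, π (G p) = h (π p) := fun p => by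
    have := congr_fun (hπ.liftHomotopy_lifts H f₀ hH₀) (1, p)
    refine this.trans ?_
    simp [H]
  have hconst : ∀ x t, (G (x, t)).1 = (G (x, 0)).1 := fun x t =>
    (isPreconnected_univ.image (fun t : ℝ => (G (x, t)).1) (by fun_prop)).subsingleton
      ⟨t, trivial, rfl⟩ ⟨0, trivial, rfl⟩
  refine ⟨fun x => (G (x, 0)).1, fun x t => (G (x, t)).2, by fun_prop, by fun_prop, fun x t => ?_⟩
  change _ = π ((G (x, 0)).1, (G (x, t)).2)
  rw [← hpG, ← hconst x t]

/-- Suppose that on the base of a mapping torus the continuous integer valued functions with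
vanishing sums over periodic orbits are coboundaries, and that the base has a dense forward orbit.
Then every orbit preserving self flow equivalence is isotopic to the identity. -/
lemma memHomeoPlusIso_mappingTorus [CompactSpace X] [T2Space X] [TotallyDisconnectedSpace X]
    [CompactSpace Y] [T2Space Y] (hS₀ : ∀ x, S 0 x = x)
    (hSadd : ∀ j k x, S (j + k) x = S j (S k x)) (hSc : ∀ k, Continuous (S k))
    {x₀ : X} (hx₀ : DenseRange fun j : ℕ => S j x₀)
    (hliv : ∀ g : X → ℤ, Continuous g → (∀ (x : X) (p : ℕ), 0 < p → S p x = x →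
      ∑ l ∈ Finset.range p, g (S l x) = 0) →
      ∃ b : X → ℤ, Continuous b ∧ ∀ x, g x = b (S 1 x) - b x)
    {γ : Y → ℝ → Y} (hγ : IsFlow γ) (hπ : IsQuotientMap π)
    (hfib : ∀ x x' t t', π (x, t) = π (x', t') ↔ ∃ n : ℤ, x' = S n x ∧ t' = t - n)
    (hflow : ∀ x t s, γ (π (x, t)) s = π (x, t + s))
    {h : Y → Y} (hh : MemHomeoPlusOrb γ h) : MemHomeoPlusIso γ h := by
  obtain ⟨hγc, hγadd, hγ₀, -⟩ := hγ
  have hh' := hh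
  obtain ⟨⟨⟨hhc, -, hloc⟩, hhomeo⟩, horb⟩ := hh'
  have hπS : ∀ (n : ℤ) x t, π (S n x, t) = π (x, t + n) := fun n x t =>
    ((hfib x (S n x) (t + n) t).2 ⟨n, rfl, by ring⟩).symm
  obtain ⟨f, s, hf, hs, hfs⟩ := exists_fibred_lift
    (isCoveringMap_mappingTorus hS₀ hSadd hSc hπ hfib) hπ.surjective hhc
  have hsx : ∀ x, Continuous (s x) := fun x => hs.comp (Continuous.prodMk_right x)
  have hmono : ∀ x, StrictMono (s x) := by
    intro x
    refine strictMono_of_local (hsx x) fun t => ?_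
    obtain ⟨ε, hε, c, hc, hcm, hc₀, hcl⟩ := hloc (π (x, t))
    refine ⟨ε, hε, fun r hr hrε => ?_⟩
    have hint : ∀ u ∈ Ioo (-ε) ε, ∃ n : ℤ, s x t + c u - s x (t + u) = n := by
      intro u hu
      have := hcl u (abs_lt.2 hu)
      rw [hflow, hfs, hfs, hflow, hfib] at this
      obtain ⟨n, -, hn⟩ := this
      exact ⟨-n, by rw [hn]; push_cast; ring⟩
    choose! N hN using hint
    have hNc : ContinuousOn N (Ioo (-ε) ε) := by
      rw [Int.isClosedEmbedding_coe_real.isInducing.continuousOn_iff]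
      refine ContinuousOn.congr (f := fun u => s x t + c u - s x (t + u)) ?_
        fun u hu => (hN u hu).symm
      exact (continuousOn_const.add hc).sub
        ((hsx x).comp (continuous_const.add continuous_id)).continuousOn
    have h0 : (0 : ℝ) ∈ Ioo (-ε) ε := ⟨by linarith, hε⟩
    have hr' : r ∈ Ioo (-ε) ε := ⟨by linarith, hrε⟩
    have hN0 : N 0 = 0 := by
      have := hN 0 h0
      simp only [hc₀, add_zero, sub_self] at this
      exact_mod_cast this.symm
    have hNr : N r = 0 := (isPreconnected_Ioo.constant hNc hr' h0).trans hN0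
    have h₁ := hN r hr'
    rw [hNr] at h₁
    have h₂ := hcm h0 hr' hr
    rw [hc₀] at h₂
    push_cast at h₁
    linarith
  have hcoc : ∀ x t, ∃ n : ℤ, f (S 1 x) = S n (f x) ∧ s (S 1 x) t = s x (t + 1) - n := by
    intro x t
    rw [← hfib, ← hfs, ← hfs, hπS]
    simp
  choose m hm₁ hm₂ using hcoc
  have hmc : Continuous fun p : X × ℝ => m p.1 p.2 := by
    apply continuous_int_of_continuous_cast
    have : (fun p : X × ℝ => (m p.1 p.2 : ℝ)) = fun p => s p.1 (p.2 + 1) - s (S 1 p.1) p.2 := by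
      ext p
      rw [hm₂]
      ring
    rw [this]
    have := hSc 1
    exact (hs.comp (continuous_fst.prodMk (continuous_snd.add continuous_const))).sub
      (hs.comp ((this.comp continuous_fst).prodMk continuous_snd))
  let n : X → ℤ := fun x => m x 0
  have hnc : Continuous n := hmc.comp (Continuous.prodMk_left 0)
  have hn₁ : ∀ x, f (S 1 x) = S (n x) (f x) := fun x => hm₁ x 0
  have hn₂ : ∀ x t, s (S 1 x) t = s x (t + 1) - n x := by
    intro x t
    rw [hm₂ x t, PreconnectedSpace.constant (f := m x) inferInstance
      (hmc.comp (Continuous.prodMk_right x)) (x := t) (y := 0)]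
  have hS1 : ∀ (j : ℕ) x, S ((j + 1 : ℕ) : ℤ) x = S 1 (S j x) := fun j x => by
    rw [← hSadd]
    congr 1
    push_cast
    ring
  have hiter : ∀ (j : ℕ) x, f (S j x) = S (∑ l ∈ Finset.range j, n (S l x)) (f x) ∧
      ∀ t, s (S j x) t = s x (t + j) - (∑ l ∈ Finset.range j, n (S l x) : ℤ) := by
    intro j x
    induction j with
    | zero => simp [hS₀]
    | succ j ih =>
      refine ⟨?_, fun t => ?_⟩
      · rw [hS1, hn₁, ih.1, ← hSadd, Finset.sum_range_succ, add_comm]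
      · rw [hS1, hn₂, ih.2, Finset.sum_range_succ]
        push_cast
        ring_nf
  have hforb : ∀ x, ∃ k : ℤ, f x = S k x := by
    intro x
    have : h (π (x, 0)) ∈ flowOrbit γ (π (x, 0)) := by
      rw [← horb]
      exact ⟨_, ⟨0, hγ₀ _⟩, rfl⟩
    obtain ⟨r, hr⟩ := this
    rw [hflow, hfs, hfib] at hr
    obtain ⟨k, hk, -⟩ := hr
    exact ⟨k, hk⟩
  have hSS : ∀ (j k : ℤ) x, S j (S k x) = S k (S j x) := fun j k x => by
    rw [← hSadd, ← hSadd, add_comm]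
  have hSinj : ∀ (k : ℤ) x y, S k x = S k y → x = y := fun k x y hxy => by
    have := congr_arg (S (-k)) hxy
    rwa [← hSadd, ← hSadd, neg_add_cancel, hS₀, hS₀] at this
  have hper : ∀ (p : ℕ) (x : X), 0 < p → S p x = x →
      ∑ l ∈ Finset.range p, n (S l x) = p := by
    intro p x
    induction p using Nat.strong_induction_on with
    | _ p ih =>
      intro hp hpx
      obtain ⟨hf₁, hs₁⟩ := hiter p x
      obtain ⟨k, hk⟩ := hforb x
      rw [hpx] at hf₁ hs₁
      set N := ∑ l ∈ Finset.range p, n (S l x) with hN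
      have hNx : S N x = x := by
        rw [hk, hSS] at hf₁
        exact (hSinj _ _ _ hf₁).symm
      have hsN : s x p = s x 0 + N := by
        have := hs₁ 0
        rw [zero_add] at this
        linarith
      have hp' : (0 : ℝ) < p := by exact_mod_cast hp
      have hNpos : 0 < N := by
        have := hmono x hp'
        rw [hsN] at this
        have : (0 : ℝ) < N := by linarith
        exact_mod_cast this
      rcases lt_trichotomy N p with hlt | heq | hgt
      · obtain ⟨q, hq⟩ := Int.eq_ofNat_of_zero_le hNpos.le
        have hq' := ih q (by omega) (by omega) (by rw [← hq, hNx])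
        have hsq := (hiter q x).2 0
        rw [← hq, hNx, hq', zero_add] at hsq
        have hqp : (q : ℝ) < p := by
          have : q < p := by omega
          exact_mod_cast this
        have := hmono x hqp
        rw [hsN, hq] at this
        push_cast at this hsq
        linarith
      · exact heq
      · exfalso
        have hgt' : (p : ℝ) < N := by exact_mod_cast hgt
        obtain ⟨t, ⟨ht₀, ht₁⟩, ht⟩ := intermediate_value_Ioo hp'.le (hsx x).continuousOn
          (show s x 0 + p ∈ Ioo (s x 0) (s x p) from ⟨by linarith, by rw [hsN]; linarith⟩)
        have hret : h (π (x, t)) = h (π (x, 0)) := by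
          have h₁ := hπS p (f x) (s x 0)
          rw [hk, hSS, hpx, ← hk] at h₁
          rw [hfs, hfs, ht, h₁]
          push_cast
          rfl
        obtain ⟨j, hj₁, hj₂⟩ := (hfib _ _ _ _).1 (hhomeo.injective hret)
        have htj : t = j := by linarith
        rw [htj] at ht₀ ht₁ ht
        have hj0 : 0 < j := by exact_mod_cast ht₀
        have hjp : j < p := by exact_mod_cast ht₁
        obtain ⟨q, rfl⟩ := Int.eq_ofNat_of_zero_le hj0.le
        have hq := ih q (by omega) (by omega) hj₁.symm
        have hsq := (hiter q x).2 0
        rw [← hj₁, hq, zero_add] at hsq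
        push_cast at ht ht₁ hsq
        linarith
  obtain ⟨b, hb, hbn⟩ := hliv (fun x => n x - 1) (hnc.sub continuous_const) fun x p hp hpx => by
    simp [hper p x hp hpx]
  have hSjoint : Continuous fun q : ℤ × X => S q.1 q.2 :=
    continuous_prod_of_discrete_left.2 hSc
  let f' : X → X := fun x => S (-b x) (f x)
  have hf' : Continuous f' := hSjoint.comp (hb.neg.prodMk hf)
  have hf'S : ∀ x, f' (S 1 x) = S 1 (f' x) := fun x => by
    simp only [f']
    rw [hn₁, ← hSadd, ← hSadd]
    congr 1
    linarith [hbn x]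
  obtain ⟨k, hk⟩ : ∃ k : ℤ, f' x₀ = S k x₀ := by
    obtain ⟨k, hk⟩ := hforb x₀
    exact ⟨-b x₀ + k, by simp only [f']; rw [hk, hSadd]⟩
  have hf'k : f' = S k := by
    refine hx₀.equalizer hf' (hSc k) (funext fun j => ?_)
    simp only [Function.comp]
    induction j with
    | zero => simpa [hS₀] using hk
    | succ j ih => rw [hS1, hf'S, ih, hSS]
  have hfk : ∀ x, f x = S (b x + k) x := fun x => by
    rw [hSadd, ← hf'k]
    simp only [f']
    rw [← hSadd, add_neg_cancel, hS₀]
  let u : X × ℝ → ℝ := fun q => s q.1 q.2 + b q.1 + k - q.2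
  have huc : Continuous u := by
    have : Continuous fun x => (b x : ℝ) := Int.isClosedEmbedding_coe_real.continuous.comp hb
    exact ((hs.add (this.comp continuous_fst)).add continuous_const).sub continuous_snd
  have hu₁ : ∀ x t, u (S 1 x, t) = u (x, t + 1) := fun x t => by
    have : (n x : ℝ) - 1 = b (S 1 x) - b x := by exact_mod_cast hbn x
    simp only [u, hn₂]
    linarith
  have hun : ∀ (j : ℤ) x t, u (S j x, t - j) = u (x, t) := by
    intro j x t
    induction j using Int.induction_on with
    | zero => simp [hS₀]
    | succ j ih =>
      rw [add_comm, hSadd, hu₁, ← ih]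
      push_cast
      ring_nf
    | pred j ih =>
      rw [← ih]
      have := hu₁ (S (-j - 1) x) (t + j)
      rw [← hSadd] at this
      push_cast
      ring_nf at this ⊢
      exact this.symm
  have hufib : ∀ q q', π q = π q' → u q = u q' := by
    rintro ⟨x, t⟩ ⟨x', t'⟩ hq
    obtain ⟨j, rfl, rfl⟩ := (hfib _ _ _ _).1 hq
    exact (hun j x t).symm
  obtain ⟨β, hβπ⟩ : ∃ β : Y → ℝ, ∀ q, β (π q) = u q :=
    ⟨fun y => u (hπ.surjective y).choose, fun q => hufib _ _ (hπ.surjective (π q)).choose_spec⟩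
  have hβ : Continuous β := by
    rw [hπ.continuous_iff]
    exact huc.congr fun q => (hβπ q).symm
  refine memHomeoPlusIso_of_cocycle hγc hγadd hγ₀ hh hβ (fun y => ?_) fun y => ?_
  · obtain ⟨⟨x, t⟩, rfl⟩ := hπ.surjective y
    rw [hβπ, hflow, hfs, hfk, hπS]
    simp only [u]
    congr 2
    push_cast
    ring
  · obtain ⟨⟨x, t⟩, rfl⟩ := hπ.surjective y
    intro r r' hrr'
    simp only [hflow, hβπ, u]
    have := hmono x (show t + r < t + r' by linarith)
    linarith

end MappingTorus

/-- Theorem 6.4 of the paper: every orbit-preserving self flow equivalence of the suspension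
flow of an irreducible shift of finite type is isotopic to the identity. Here `Y` together
with the quotient map `π : X × ℝ → Y` is (a model of) the mapping torus of the shift on `X`,
and `γ` is the suspension flow. -/
theorem irreducible_sft_orbit_to_iso {A : Type*} [Finite A] [TopologicalSpace A]
    [DiscreteTopology A]
    (X : Set (ℤ → A)) (hsub : IsSubshift X) (hSFT : IsSFT X) (hirr : IsIrreducibleSubshift X)
    {Y : Type*} [MetricSpace Y] [CompactSpace Y] (γ : Y → ℝ → Y) (hγ : IsFlow γ)
    (π : X × ℝ → Y) (hπq : IsQuotientMap π)
    (hπfib : ∀ (x x' : X) (t t' : ℝ), π (x, t) = π (x', t') ↔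
      ∃ n : ℤ, (∀ m : ℤ, (x' : ℤ → A) m = (x : ℤ → A) (m + n)) ∧ t' = t - n)
    (hπflow : ∀ (x : X) (t s : ℝ), γ (π (x, t)) s = π (x, t + s))
    (h : Y → Y) (hh : MemHomeoPlusOrb γ h) :
    MemHomeoPlusIso γ h := by
  have hcA : CompactSpace X := isCompact_iff_compactSpace.1 hsub.2.1.isCompact
  obtain ⟨x₀, hx₀⟩ := exists_forward_transitive hSFT hsub.1 hirr
  refine memHomeoPlusIso_mappingTorus (sftShift_zero hSFT) (sftShift_add hSFT)
    (continuous_sftShift hSFT) (denseRange_of_forward_transitive hSFT hx₀)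
    (fun g hg => exists_coboundary hSFT hx₀ hg) hγ hπq (fun x x' t t' => ?_) hπflow hh
  rw [hπfib]
  simp only [Subtype.ext_iff, funext_iff, sftShift_apply]
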